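/- The 2-abelian complexity sequence (P²_t(n))_{n≥0} of the Thue–Morse word is 2-regular. -/

import Mathlib

/-- The 2-kernel of a sequence `s : ℕ → ℤ`. -/
def kernel2 (s : ℕ → ℤ) : Set (ℕ → ℤ) :=
  {t | ∃ i j : ℕ, j < 2 ^ i ∧ t = fun n => s (2 ^ i * n + j)}

/-- A sequence is 2-regular if the ℤ-module spanned by its 2-kernel is finitely generated. -/
def IsTwoRegular (s : ℕ → ℤ) : Prop :=
  (Submodule.span ℤ (kernel2 s)).FG

/-- A sequence is 2-automatic if its 2-kernel is finite. -/
def IsTwoAutomatic (s : ℕ → ℤ) : Prop :=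
  (kernel2 s).Finite

/-- The period-doubling word, fixed point (starting with 0) of 0 ↦ 01, 1 ↦ 00:
its `n`-th letter is the parity of the 2-adic valuation of `n+1`. -/
def pd (n : ℕ) : ℕ := (n + 1).factorization 2 % 2

/-- The Thue–Morse word, fixed point (starting with 0) of 0 ↦ 01, 1 ↦ 10:
its `n`-th letter is the parity of the binary digit sum of `n`. -/
def tm (n : ℕ) : ℕ := (Nat.digits 2 n).sum % 2

/-- The 2-block coding `x = block(p, 2)` of the period-doubling word. -/
def xw (n : ℕ) : ℕ := 2 * pd n + pd (n + 1)

/-- The 2-block coding `y = block(t, 2)` of the Thue–Morse word. -/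
def yw (n : ℕ) : ℕ := 2 * tm n + tm (n + 1)

/-- The factor of an infinite word `w` of length `len` occurring at position `i`. -/
def factorAt (w : ℕ → ℕ) (i len : ℕ) : List ℕ :=
  (List.range len).map fun k => w (i + k)

/-- `u` is a factor of the infinite word `w`. -/
def IsFactor (w : ℕ → ℕ) (u : List ℕ) : Prop :=
  ∃ i, u = factorAt w i u.length

/-- Maximal number of 0's in a factor of `x` of length `n`. -/
noncomputable def M0 (n : ℕ) : ℕ := sSup {k | ∃ i, (factorAt xw i n).count 0 = k}

/-- Minimal number of 0's in a factor of `x` of length `n`. -/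
noncomputable def m0 (n : ℕ) : ℕ := sInf {k | ∃ i, (factorAt xw i n).count 0 = k}

noncomputable def D0 (n : ℕ) : ℕ := M0 n - m0 n

/-- Maximal number of 2's in a factor of `x` of length `n`. -/
noncomputable def M2c (n : ℕ) : ℕ := sSup {k | ∃ i, (factorAt xw i n).count 2 = k}

/-- Minimal number of 2's in a factor of `x` of length `n`. -/
noncomputable def m2c (n : ℕ) : ℕ := sInf {k | ∃ i, (factorAt xw i n).count 2 = k}

/-- The max-jump function for `M0`. -/
noncomputable def JM0 : ℕ → ℕ
  | 0 => 0
  | n + 1 => if M0 n < M0 (n + 1) then 1 else 0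

/-- The min-jump function for `m0`. -/
noncomputable def jm0 (n : ℕ) : ℕ := if m0 n < m0 (n + 1) then 1 else 0

/-- Maximal total number of 1's and 2's in a factor of `y` of length `n`. -/
noncomputable def M12 (n : ℕ) : ℕ :=
  sSup {k | ∃ i, (factorAt yw i n).count 1 + (factorAt yw i n).count 2 = k}

/-- Minimal total number of 1's and 2's in a factor of `y` of length `n`. -/
noncomputable def m12 (n : ℕ) : ℕ :=
  sInf {k | ∃ i, (factorAt yw i n).count 1 + (factorAt yw i n).count 2 = k}

noncomputable def D12 (n : ℕ) : ℕ := M12 n - m12 n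

/-- Maximal total number of 0's and 3's in a factor of `y` of length `n`. -/
noncomputable def M03 (n : ℕ) : ℕ :=
  sSup {k | ∃ i, (factorAt yw i n).count 0 + (factorAt yw i n).count 3 = k}

/-- Minimal total number of 0's and 3's in a factor of `y` of length `n`. -/
noncomputable def m03 (n : ℕ) : ℕ :=
  sInf {k | ∃ i, (factorAt yw i n).count 0 + (factorAt yw i n).count 3 = k}

/-- The max-jump function for `M03`. -/
noncomputable def JM03 (n : ℕ) : ℕ := if M03 (n - 1) < M03 n then 1 else 0

/-- The min-jump function for `m03`. -/
noncomputable def jm03 (n : ℕ) : ℕ := if m03 n < m03 (n + 1) then 1 else 0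

/-- Abelian complexity: the number of abelian equivalence classes (i.e. distinct
multisets of letters) of factors of `w` of length `n`. -/
noncomputable def abComplexity (w : ℕ → ℕ) (n : ℕ) : ℕ :=
  Set.ncard {m : Multiset ℕ | ∃ i, (↑(factorAt w i n) : Multiset ℕ) = m}

/-- The number of occurrences of `v` as a factor of `u`. -/
def countFactor (u v : List ℕ) : ℕ :=
  ((List.range (u.length + 1 - v.length)).filter
    fun i => decide ((u.drop i).take v.length = v)).length

/-- 2-abelian complexity: the number of 2-abelian equivalence classes of factors of `w`
of length `n`, where two words are 2-abelian equivalent when every word of length at most 2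
occurs equally often in both. -/
noncomputable def abel2Complexity (w : ℕ → ℕ) (n : ℕ) : ℕ :=
  Set.ncard {f : List ℕ → ℕ |
    ∃ i, f = fun v => if v.length ≤ 2 then countFactor (factorAt w i n) v else 0}

/-- The morphism φ : 0 ↦ 12, 1 ↦ 12, 2 ↦ 00. -/
def phiL : ℕ → List ℕ
  | 0 => [1, 2]
  | 1 => [1, 2]
  | 2 => [0, 0]
  | _ => []

/-- The morphism τ : 0 ↦ 0, 1 ↦ 2, 2 ↦ 1. -/
def tauL : ℕ → ℕ
  | 1 => 2
  | 2 => 1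
  | n => n

/-! ### Sequences in decimation-closed modules -/

/-- The subsequence of even-indexed terms. -/
def evenPart : (ℕ → ℤ) →ₗ[ℤ] (ℕ → ℤ) := LinearMap.funLeft ℤ ℤ fun n => 2 * n

/-- The subsequence of odd-indexed terms. -/
def oddPart : (ℕ → ℤ) →ₗ[ℤ] (ℕ → ℤ) := LinearMap.funLeft ℤ ℤ fun n => 2 * n + 1

/-- The sequence with its first term removed. -/
def shiftSeq : (ℕ → ℤ) →ₗ[ℤ] (ℕ → ℤ) := LinearMap.funLeft ℤ ℤ fun n => n + 1

/-- A module of sequences closed under taking even-indexed and odd-indexed subsequences. -/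
def DecimationClosed (N : Submodule ℤ (ℕ → ℤ)) : Prop :=
  ∀ s ∈ N, evenPart s ∈ N ∧ oddPart s ∈ N

theorem isTwoRegular_of_mem {N : Submodule ℤ (ℕ → ℤ)} (hfg : N.FG) (hN : DecimationClosed N)
    {s : ℕ → ℤ} (hs : s ∈ N) : IsTwoRegular s := by
  have hmem : ∀ i j : ℕ, j < 2 ^ i → (fun n => s (2 ^ i * n + j)) ∈ N := by
    intro i
    induction i with
    | zero =>
      intro j hj
      obtain rfl : j = 0 := by simpa using hj
      simpa using hs
    | succ i ih =>
      intro j hj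
      rcases lt_or_ge j (2 ^ i) with h | h
      · convert (hN _ (ih j h)).1 using 1
        funext n
        simp only [evenPart, LinearMap.funLeft_apply]
        congr 1
        ring
      · convert (hN _ (ih (j - 2 ^ i) (by rw [pow_succ] at hj; omega))).2 using 1
        funext n
        simp only [oddPart, LinearMap.funLeft_apply]
        congr 1
        rw [mul_add, mul_one, add_assoc, Nat.add_sub_cancel' h]
        ring
  have hle : Submodule.span ℤ (kernel2 s) ≤ N := by
    rw [Submodule.span_le]
    rintro _ ⟨i, j, hj, rfl⟩
    exact hmem i j hj
  exact hfg.of_le hle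

theorem decimationClosed_span {G : Set (ℕ → ℤ)}
    (hG : ∀ s ∈ G, evenPart s ∈ Submodule.span ℤ G ∧ oddPart s ∈ Submodule.span ℤ G) :
    DecimationClosed (Submodule.span ℤ G) := by
  intro s hs
  induction hs using Submodule.span_induction with
  | mem x hx => exact hG x hx
  | zero => simp
  | add x y _ _ hx hy =>
    simp only [map_add]
    exact ⟨add_mem hx.1 hy.1, add_mem hx.2 hy.2⟩
  | smul a x _ hx =>
    simp only [map_smul]
    exact ⟨Submodule.smul_mem _ a hx.1, Submodule.smul_mem _ a hx.2⟩

theorem fg_comap_shiftSeq {N : Submodule ℤ (ℕ → ℤ)} (hfg : N.FG) :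
    (N.comap shiftSeq).FG := by
  refine Submodule.fg_of_fg_map_of_fg_inf_ker shiftSeq
    (hfg.of_le (Submodule.map_comap_le _ _)) ?_
  refine Submodule.FG.of_le (Submodule.fg_span_singleton (Pi.single 0 1 : ℕ → ℤ)) ?_
  rintro s ⟨-, hs⟩
  rw [Submodule.mem_span_singleton]
  refine ⟨s 0, ?_⟩
  funext n
  cases n with
  | zero => simp
  | succ n =>
    have := congrFun (LinearMap.mem_ker.1 hs) n
    simp only [shiftSeq, LinearMap.funLeft_apply, Pi.zero_apply] at this
    simp [this]

/-- A sequence is 2-regular as soon as its terms of odd index and its terms of positive even index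
form sequences in a finitely generated decimation-closed module. -/
theorem isTwoRegular_of_odd_of_even_succ {N : Submodule ℤ (ℕ → ℤ)} (hfg : N.FG)
    (hN : DecimationClosed N) {s : ℕ → ℤ} (hodd : (fun n => s (2 * n + 1)) ∈ N)
    (heven : (fun n => s (2 * n + 2)) ∈ N) : IsTwoRegular s := by
  refine isTwoRegular_of_mem (N := N.comap shiftSeq ⊔ N ⊔ Submodule.span ℤ {s})
    (((fg_comap_shiftSeq hfg).sup hfg).sup (Submodule.fg_span_singleton s)) ?_
    (Submodule.mem_sup_right (Submodule.mem_span_singleton_self s))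
  have hcomap : ∀ u ∈ N.comap shiftSeq, evenPart u ∈ N.comap shiftSeq ∧ oddPart u ∈ N :=
    fun u hu => ⟨(hN _ hu).2, (hN _ hu).1⟩
  intro u hu
  obtain ⟨v, hv, z, hz, rfl⟩ := Submodule.mem_sup.1 hu
  obtain ⟨x, hx, y, hy, rfl⟩ := Submodule.mem_sup.1 hv
  obtain ⟨a, rfl⟩ := Submodule.mem_span_singleton.1 hz
  have hse : evenPart s ∈ N.comap shiftSeq := heven
  have hso : oddPart s ∈ N := hodd
  simp only [map_add, map_smul]
  refine ⟨Submodule.mem_sup_left (add_mem (add_mem ?_ ?_) (Submodule.smul_mem _ a ?_)),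
    Submodule.mem_sup_left (add_mem (add_mem ?_ ?_) (Submodule.smul_mem _ a ?_))⟩
  · exact Submodule.mem_sup_left (hcomap x hx).1
  · exact Submodule.mem_sup_right (hN y hy).1
  · exact Submodule.mem_sup_left hse
  · exact Submodule.mem_sup_right (hcomap x hx).2
  · exact Submodule.mem_sup_right (hN y hy).2
  · exact Submodule.mem_sup_right hso

/-! ### Repeated letters in the Thue–Morse word -/

theorem tm_two_mul (n : ℕ) : tm (2 * n) = tm n := by
  rcases Nat.eq_zero_or_pos n with rfl | h
  · simp
  · simp [tm, Nat.digits_def' (b := 2) (by norm_num) (show 0 < 2 * n by omega)]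

theorem tm_lt_two (n : ℕ) : tm n < 2 := Nat.mod_lt _ (by norm_num)

theorem tm_two_mul_add_one (n : ℕ) : tm (2 * n + 1) = 1 - tm n := by
  have h : tm (2 * n + 1) = (1 + (Nat.digits 2 n).sum) % 2 := by
    rw [tm, Nat.digits_def' (by norm_num) (by omega)]
    have h1 : (2 * n + 1) % 2 = 1 := by omega
    have h2 : (2 * n + 1) / 2 = n := by omega
    rw [h1, h2, List.sum_cons]
  rw [h, tm]
  omega

theorem tm_add_two_pow (K : ℕ) : ∀ n < 2 ^ K, tm (n + 2 ^ K) = 1 - tm n := by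
  induction K with
  | zero =>
    intro n hn
    obtain rfl : n = 0 := by simpa using hn
    have := tm_two_mul_add_one 0
    simpa using this
  | succ K ih =>
    intro n hn
    rw [pow_succ] at hn ⊢
    rcases Nat.even_or_odd' n with ⟨k, rfl | rfl⟩
    · rw [show 2 * k + 2 ^ K * 2 = 2 * (k + 2 ^ K) by ring, tm_two_mul, tm_two_mul,
        ih k (by omega)]
    · rw [show 2 * k + 1 + 2 ^ K * 2 = 2 * (k + 2 ^ K) + 1 by ring, tm_two_mul_add_one,
        tm_two_mul_add_one, ih k (by omega)]

/-- The indicator of a letter of the Thue–Morse word being equal to the next one. -/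
def rep (k : ℕ) : ℤ := if tm k = tm (k + 1) then 1 else 0

theorem rep_two_mul (k : ℕ) : rep (2 * k) = 0 := by
  have := tm_lt_two k
  rw [rep, if_neg]
  rw [tm_two_mul, tm_two_mul_add_one]
  omega

theorem rep_two_mul_add_one (k : ℕ) : rep (2 * k + 1) = 1 - rep k := by
  have h0 := tm_lt_two k
  have h1 := tm_lt_two (k + 1)
  rw [rep, rep, show 2 * k + 1 + 1 = 2 * (k + 1) by ring, tm_two_mul, tm_two_mul_add_one]
  split_ifs <;> omega

theorem rep_eq_zero_or_one (k : ℕ) : rep k = 0 ∨ rep k = 1 := by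
  rw [rep]
  split_ifs <;> simp

/-- The number of repetitions `tm k = tm (k + 1)` with `i ≤ k < i + m`. -/
def repCount (i m : ℕ) : ℤ := ∑ k ∈ Finset.range m, rep (i + k)

theorem repCount_succ (i m : ℕ) : repCount i (m + 1) = repCount i m + rep (i + m) :=
  Finset.sum_range_succ _ _

theorem repCount_two_mul_two_mul (j k : ℕ) : repCount (2 * j) (2 * k) = k - repCount j k := by
  induction k with
  | zero => simp [repCount]
  | succ k ih =>
    rw [show 2 * (k + 1) = 2 * k + 1 + 1 by ring, repCount_succ, repCount_succ, ih, repCount_succ,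
      show 2 * j + (2 * k + 1) = 2 * (j + k) + 1 by ring, ← mul_add, rep_two_mul,
      rep_two_mul_add_one]
    push_cast
    ring

theorem repCount_two_mul_two_mul_add_one (j k : ℕ) :
    repCount (2 * j) (2 * k + 1) = k - repCount j k := by
  rw [repCount_succ, repCount_two_mul_two_mul, ← mul_add, rep_two_mul, add_zero]

theorem repCount_two_mul_add_one_two_mul (j k : ℕ) :
    repCount (2 * j + 1) (2 * k) = k - repCount j k := by
  induction k with
  | zero => simp [repCount]
  | succ k ih =>
    rw [show 2 * (k + 1) = 2 * k + 1 + 1 by ring, repCount_succ, repCount_succ, ih, repCount_succ,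
      show 2 * j + 1 + (2 * k + 1) = 2 * (j + k + 1) by ring,
      show 2 * j + 1 + 2 * k = 2 * (j + k) + 1 by ring, rep_two_mul, rep_two_mul_add_one]
    push_cast
    ring

theorem repCount_two_mul_add_one_two_mul_add_one (j k : ℕ) :
    repCount (2 * j + 1) (2 * k + 1) = (k + 1 : ℕ) - repCount j (k + 1) := by
  rw [repCount_succ, repCount_two_mul_add_one_two_mul,
    show 2 * j + 1 + 2 * k = 2 * (j + k) + 1 by ring, rep_two_mul_add_one, repCount_succ]
  push_cast
  ring

theorem repCount_mem_Icc (i m : ℕ) : repCount i m ∈ Set.Icc (0 : ℤ) m := by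
  induction m with
  | zero => simp [repCount]
  | succ m ih =>
    rw [repCount_succ]
    have h := rep_eq_zero_or_one (i + m)
    simp only [Set.mem_Icc] at ih ⊢
    push_cast
    omega

theorem repCount_start_succ (i m : ℕ) :
    repCount (i + 1) m = repCount i m - rep i + rep (i + m) := by
  have h1 := repCount_succ i m
  have h2 : repCount i (m + 1) = repCount (i + 1) m + rep i := by
    rw [repCount, repCount, Finset.sum_range_succ', add_zero]
    congr 1
    refine Finset.sum_congr rfl fun k _ => ?_
    congr 1
    ring
  linarith

/-! ### Extremal numbers of repetitions -/

/-- The maximal number of repetitions at `m` consecutive places of the Thue–Morse word. -/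
noncomputable def maxRep (m : ℕ) : ℤ := sSup (Set.range fun i => repCount i m)

/-- The minimal number of repetitions at `m` consecutive places of the Thue–Morse word. -/
noncomputable def minRep (m : ℕ) : ℤ := sInf (Set.range fun i => repCount i m)

theorem isGreatest_maxRep (m : ℕ) : IsGreatest (Set.range fun i => repCount i m) (maxRep m) := by
  have hb : BddAbove (Set.range fun i => repCount i m) :=
    ⟨m, by rintro _ ⟨i, rfl⟩; exact (repCount_mem_Icc i m).2⟩
  exact ⟨Int.csSup_mem (Set.range_nonempty _) hb, fun x hx => le_csSup hb hx⟩

theorem isLeast_minRep (m : ℕ) : IsLeast (Set.range fun i => repCount i m) (minRep m) := by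
  have hb : BddBelow (Set.range fun i => repCount i m) :=
    ⟨0, by rintro _ ⟨i, rfl⟩; exact (repCount_mem_Icc i m).1⟩
  exact ⟨Int.csInf_mem (Set.range_nonempty _) hb, fun x hx => csInf_le hb hx⟩

theorem repCount_le_maxRep (i m : ℕ) : repCount i m ≤ maxRep m := (isGreatest_maxRep m).2 ⟨i, rfl⟩

theorem minRep_le_repCount (i m : ℕ) : minRep m ≤ repCount i m := (isLeast_minRep m).2 ⟨i, rfl⟩

theorem exists_repCount_eq_maxRep (m : ℕ) : ∃ i, repCount i m = maxRep m := (isGreatest_maxRep m).1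

theorem exists_repCount_eq_minRep (m : ℕ) : ∃ i, repCount i m = minRep m := (isLeast_minRep m).1

theorem minRep_le_maxRep (m : ℕ) : minRep m ≤ maxRep m :=
  (minRep_le_repCount 0 m).trans (repCount_le_maxRep 0 m)

/-- An integer sequence with steps of size at most one takes all intermediate values. -/
theorem exists_eq_of_abs_step_le_one {f : ℕ → ℤ} (hf : ∀ k, |f (k + 1) - f k| ≤ 1) {a b : ℕ}
    {c : ℤ} (ha : f a ≤ c) (hb : c ≤ f b) : ∃ k, f k = c := by
  by_contra! hne
  have hstep : ∀ k, f k ≤ c ↔ f (k + 1) ≤ c := by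
    intro k
    have h1 := abs_le.1 (hf k)
    have h2 := hne k
    have h3 := hne (k + 1)
    omega
  have hall : ∀ k, f k ≤ c ↔ f 0 ≤ c := by
    intro k
    induction k with
    | zero => rfl
    | succ k ih => rw [← hstep, ih]
  have := (hall b).2 ((hall a).1 ha)
  exact hne b (le_antisymm this hb)

theorem range_repCount (m : ℕ) :
    (Set.range fun i => repCount i m) = Set.Icc (minRep m) (maxRep m) := by
  ext c
  constructor
  · rintro ⟨i, rfl⟩
    exact ⟨minRep_le_repCount i m, repCount_le_maxRep i m⟩
  · rintro ⟨h1, h2⟩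
    obtain ⟨a, ha⟩ := exists_repCount_eq_minRep m
    obtain ⟨b, hb⟩ := exists_repCount_eq_maxRep m
    refine exists_eq_of_abs_step_le_one (a := a) (b := b) (fun k => ?_) (ha.trans_le h1)
      (h2.trans_eq hb.symm)
    rw [repCount_start_succ, abs_le]
    have := rep_eq_zero_or_one k
    have := rep_eq_zero_or_one (k + m)
    omega

theorem maxRep_two_mul (k : ℕ) : maxRep (2 * k) = k - minRep k := by
  refine (isGreatest_maxRep _).unique ⟨?_, ?_⟩
  · obtain ⟨i, hi⟩ := exists_repCount_eq_minRep k
    exact ⟨2 * i, by simp only [repCount_two_mul_two_mul, hi]⟩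
  · rintro _ ⟨i, rfl⟩
    obtain ⟨j, rfl | rfl⟩ := Nat.even_or_odd' i
    · have := minRep_le_repCount j k
      simp only [repCount_two_mul_two_mul]
      omega
    · have := minRep_le_repCount j k
      simp only [repCount_two_mul_add_one_two_mul]
      omega

theorem minRep_two_mul (k : ℕ) : minRep (2 * k) = k - maxRep k := by
  refine (isLeast_minRep _).unique ⟨?_, ?_⟩
  · obtain ⟨i, hi⟩ := exists_repCount_eq_maxRep k
    exact ⟨2 * i, by simp only [repCount_two_mul_two_mul, hi]⟩
  · rintro _ ⟨i, rfl⟩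
    obtain ⟨j, rfl | rfl⟩ := Nat.even_or_odd' i
    · have := repCount_le_maxRep j k
      simp only [repCount_two_mul_two_mul]
      omega
    · have := repCount_le_maxRep j k
      simp only [repCount_two_mul_add_one_two_mul]
      omega

theorem maxRep_two_mul_add_one (k : ℕ) : maxRep (2 * k + 1) = (k + 1 : ℕ) - minRep (k + 1) := by
  refine (isGreatest_maxRep _).unique ⟨?_, ?_⟩
  · obtain ⟨i, hi⟩ := exists_repCount_eq_minRep (k + 1)
    exact ⟨2 * i + 1, by simp only [repCount_two_mul_add_one_two_mul_add_one, hi]⟩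
  · rintro _ ⟨i, rfl⟩
    obtain ⟨j, rfl | rfl⟩ := Nat.even_or_odd' i
    · have h1 := minRep_le_repCount j (k + 1)
      have h2 := rep_eq_zero_or_one (j + k)
      rw [repCount_succ] at h1
      simp only [repCount_two_mul_two_mul_add_one]
      omega
    · have := minRep_le_repCount j (k + 1)
      simp only [repCount_two_mul_add_one_two_mul_add_one]
      omega

theorem minRep_two_mul_add_one (k : ℕ) : minRep (2 * k + 1) = k - maxRep k := by
  refine (isLeast_minRep _).unique ⟨?_, ?_⟩
  · obtain ⟨i, hi⟩ := exists_repCount_eq_maxRep k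
    exact ⟨2 * i, by simp only [repCount_two_mul_two_mul_add_one, hi]⟩
  · rintro _ ⟨i, rfl⟩
    obtain ⟨j, rfl | rfl⟩ := Nat.even_or_odd' i
    · have := repCount_le_maxRep j k
      simp only [repCount_two_mul_two_mul_add_one]
      omega
    · have h1 := repCount_le_maxRep j k
      have h2 := rep_eq_zero_or_one (j + k)
      simp only [repCount_two_mul_add_one_two_mul_add_one, repCount_succ]
      omega

/-! ### 2-abelian classes of factors of the Thue–Morse word -/

theorem factorAt_length (w : ℕ → ℕ) (i n : ℕ) : (factorAt w i n).length = n := by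
  simp [factorAt]

theorem take_drop_factorAt (w : ℕ → ℕ) (i : ℕ) {n k l : ℕ} (h : k + l ≤ n) :
    ((factorAt w i n).drop k).take l = factorAt w (i + k) l := by
  apply List.ext_getElem
  · simp [factorAt]
    omega
  · intro a h1 h2
    simp [factorAt, add_assoc]

theorem countFactor_factorAt (w : ℕ → ℕ) (i n : ℕ) (v : List ℕ) :
    (countFactor (factorAt w i n) v : ℤ) =
      ∑ k ∈ Finset.range (n + 1 - v.length), if factorAt w (i + k) v.length = v then 1 else 0 := by
  have h : countFactor (factorAt w i n) v =
      ((Finset.range (n + 1 - v.length)).filter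
        fun k => factorAt w (i + k) v.length = v).card := by
    rw [countFactor, factorAt_length]
    have : ∀ k ∈ List.range (n + 1 - v.length),
        decide (((factorAt w i n).drop k).take v.length = v) =
          decide (factorAt w (i + k) v.length = v) := by
      intro k hk
      rw [List.mem_range] at hk
      rw [take_drop_factorAt w i (by omega)]
    rw [List.filter_congr this]
    rfl
  rw [h, Finset.card_filter]
  push_cast
  rfl

/-- The number of occurrences of the letter `x` in the factor of length `n` at position `i`. -/
def letterCount (i n x : ℕ) : ℤ := ∑ k ∈ Finset.range n, if tm (i + k) = x then 1 else 0

/-- The number of occurrences of `xy` in the factor of length `m + 1` at position `i`. -/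
def pairCount (i m x y : ℕ) : ℤ :=
  ∑ k ∈ Finset.range m, if tm (i + k) = x ∧ tm (i + k + 1) = y then 1 else 0

theorem countFactor_singleton (i n x : ℕ) :
    (countFactor (factorAt tm i n) [x] : ℤ) = letterCount i n x := by
  rw [countFactor_factorAt, letterCount]
  simp [factorAt]

theorem countFactor_pair (i m x y : ℕ) :
    (countFactor (factorAt tm i (m + 1)) [x, y] : ℤ) = pairCount i m x y := by
  rw [countFactor_factorAt, pairCount]
  simp [factorAt, List.range_succ]

theorem countFactor_nil (i n : ℕ) : countFactor (factorAt tm i n) [] = n + 1 := by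
  simp [countFactor, factorAt_length]

theorem letterCount_of_two_le (i n : ℕ) {x : ℕ} (hx : 2 ≤ x) : letterCount i n x = 0 :=
  Finset.sum_eq_zero fun k _ => if_neg (by have := tm_lt_two (i + k); omega)

theorem pairCount_of_two_le (i m : ℕ) {x y : ℕ} (h : 2 ≤ x ∨ 2 ≤ y) : pairCount i m x y = 0 :=
  Finset.sum_eq_zero fun k _ => if_neg (by
    have := tm_lt_two (i + k)
    have := tm_lt_two (i + k + 1)
    omega)

theorem letterCount_succ (i n x : ℕ) :
    letterCount i (n + 1) x = letterCount i n x + if tm (i + n) = x then 1 else 0 :=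
  Finset.sum_range_succ _ _

theorem pairCount_succ (i m x y : ℕ) :
    pairCount i (m + 1) x y =
      pairCount i m x y + if tm (i + m) = x ∧ tm (i + m + 1) = y then 1 else 0 :=
  Finset.sum_range_succ _ _

theorem pairCount_zero_zero_add_one_one (i m : ℕ) :
    pairCount i m 0 0 + pairCount i m 1 1 = repCount i m := by
  induction m with
  | zero => simp [pairCount, repCount]
  | succ m ih =>
    have h0 := tm_lt_two (i + m)
    have h1 := tm_lt_two (i + m + 1)
    rw [pairCount_succ, pairCount_succ, repCount_succ, rep]
    split_ifs <;> omega

theorem letterCount_zero_add_one (i n : ℕ) : letterCount i n 0 + letterCount i n 1 = n := by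
  induction n with
  | zero => simp [letterCount]
  | succ n ih =>
    have h0 := tm_lt_two (i + n)
    rw [letterCount_succ, letterCount_succ]
    push_cast
    split_ifs <;> omega

theorem letterCount_one_eq_start (i m : ℕ) :
    letterCount i (m + 1) 1 = tm i + pairCount i m 0 1 + pairCount i m 1 1 := by
  induction m with
  | zero =>
    have h0 := tm_lt_two i
    simp only [letterCount, pairCount, Finset.sum_range_succ, Finset.sum_range_zero, add_zero,
      zero_add]
    split_ifs <;> omega
  | succ m ih =>
    have h0 := tm_lt_two (i + m)
    have h1 := tm_lt_two (i + m + 1)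
    rw [letterCount_succ, pairCount_succ, pairCount_succ, ih, ← add_assoc]
    split_ifs <;> omega

theorem letterCount_one_eq_end (i m : ℕ) :
    letterCount i (m + 1) 1 = tm (i + m) + pairCount i m 1 0 + pairCount i m 1 1 := by
  induction m with
  | zero =>
    have h0 := tm_lt_two i
    simp only [letterCount, pairCount, Finset.sum_range_succ, Finset.sum_range_zero, add_zero,
      zero_add]
    split_ifs <;> omega
  | succ m ih =>
    have h0 := tm_lt_two (i + m)
    have h1 := tm_lt_two (i + m + 1)
    rw [letterCount_succ, pairCount_succ, pairCount_succ, ih, ← add_assoc]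
    split_ifs <;> omega

theorem letterCount_zero_eq_end (i m : ℕ) :
    letterCount i (m + 1) 0 = (1 - tm (i + m)) + pairCount i m 0 0 + pairCount i m 0 1 := by
  induction m with
  | zero =>
    have h0 := tm_lt_two i
    simp only [letterCount, pairCount, Finset.sum_range_succ, Finset.sum_range_zero, add_zero,
      zero_add]
    split_ifs <;> omega
  | succ m ih =>
    have h0 := tm_lt_two (i + m)
    have h1 := tm_lt_two (i + m + 1)
    rw [letterCount_succ, pairCount_succ, pairCount_succ, ih, ← add_assoc]
    split_ifs <;> omega

/-- The last letter of a factor is determined by the first one and the number of repetitions. -/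
theorem tm_add_emod_two (i m : ℕ) : (tm (i + m) : ℤ) % 2 = (tm i + m + repCount i m) % 2 := by
  induction m with
  | zero => simp [repCount]
  | succ m ih =>
    have h0 := tm_lt_two (i + m)
    have h1 := tm_lt_two (i + m + 1)
    rw [repCount_succ, rep, ← add_assoc]
    push_cast
    split_ifs <;> omega

/-- In the Thue–Morse word, letters outside the boundary of a factor are balanced. -/
theorem letterCount_zero_sub_one (i m : ℕ) :
    letterCount i (m + 1) 0 - letterCount i (m + 1) 1 =
      (if i % 2 = 1 then 1 - 2 * (tm i : ℤ) else 0) +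
        if (i + m) % 2 = 0 then 1 - 2 * (tm (i + m) : ℤ) else 0 := by
  induction m with
  | zero =>
    have h0 := tm_lt_two i
    simp only [letterCount, Finset.sum_range_succ, Finset.sum_range_zero, add_zero, zero_add]
    split_ifs <;> omega
  | succ m ih =>
    have h0 := tm_lt_two (i + m)
    have h1 := tm_lt_two (i + m + 1)
    have h2 : (i + m) % 2 = 0 → tm (i + m + 1) = 1 - tm (i + m) := by
      intro h
      obtain ⟨k, hk⟩ : ∃ k, i + m = 2 * k := ⟨(i + m) / 2, by omega⟩
      rw [hk, tm_two_mul, tm_two_mul_add_one]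
    rw [letterCount_succ, letterCount_succ (x := 1), ← add_assoc]
    split_ifs at ih ⊢ <;> omega

/-- The function attached by `abel2Complexity` to the factor of length `n` at position `i`. -/
def abel2Class (n i : ℕ) : List ℕ → ℕ :=
  fun v => if v.length ≤ 2 then countFactor (factorAt tm i n) v else 0

theorem tm_add_eq_tm_add {m i j : ℕ} (htm : tm i = tm j) (hrep : repCount i m = repCount j m) :
    tm (i + m) = tm (j + m) := by
  have h1 := tm_add_emod_two i m
  have h2 := tm_add_emod_two j m
  rw [← htm, ← hrep, ← h1] at h2
  have h3 := tm_lt_two (i + m)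
  have h4 := tm_lt_two (j + m)
  omega

theorem letterCount_zero_sub_one_eq_iff {m i j : ℕ} (htm : tm i = tm j)
    (hrep : repCount i m = repCount j m) :
    letterCount i (m + 1) 0 - letterCount i (m + 1) 1 =
        letterCount j (m + 1) 0 - letterCount j (m + 1) 1 ↔
      (Odd (repCount i m) → i % 2 = j % 2) := by
  rw [letterCount_zero_sub_one, letterCount_zero_sub_one, ← tm_add_eq_tm_add htm hrep, ← htm,
    Int.odd_iff]
  have h1 := tm_add_emod_two i m
  have h2 := tm_lt_two i
  have h3 := tm_lt_two (i + m)
  generalize tm (i + m) = y at *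
  generalize tm i = x at *
  generalize repCount i m = e at *
  clear htm hrep
  have hx : x = 0 ∨ x = 1 := by omega
  have hy : y = 0 ∨ y = 1 := by omega
  rcases hx with rfl | rfl <;> rcases hy with rfl | rfl <;> split_ifs <;> norm_num at * <;> omega

theorem abel2Class_eq_iff_counts (m i j : ℕ) :
    abel2Class (m + 1) i = abel2Class (m + 1) j ↔
      (∀ x, letterCount i (m + 1) x = letterCount j (m + 1) x) ∧
        ∀ x y, pairCount i m x y = pairCount j m x y := by
  simp only [← countFactor_singleton, ← countFactor_pair, Nat.cast_inj]
  constructor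
  · intro h
    exact ⟨fun x => by simpa [abel2Class] using congrFun h [x],
      fun x y => by simpa [abel2Class] using congrFun h [x, y]⟩
  · rintro ⟨hl, hp⟩
    funext v
    rcases v with _ | ⟨x, _ | ⟨y, _ | ⟨z, v⟩⟩⟩
    · simp [abel2Class, countFactor_nil]
    · simpa [abel2Class] using hl x
    · simpa [abel2Class] using hp x y
    · simp [abel2Class]

theorem abel2Class_eq_iff (m i j : ℕ) :
    abel2Class (m + 1) i = abel2Class (m + 1) j ↔
      tm i = tm j ∧ repCount i m = repCount j m ∧ (Odd (repCount i m) → i % 2 = j % 2) := by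
  have i1 := pairCount_zero_zero_add_one_one i m
  have i2 := letterCount_zero_add_one i (m + 1)
  have i3 := letterCount_one_eq_start i m
  have i4 := letterCount_one_eq_end i m
  have i5 := letterCount_zero_eq_end i m
  have j1 := pairCount_zero_zero_add_one_one j m
  have j2 := letterCount_zero_add_one j (m + 1)
  have j3 := letterCount_one_eq_start j m
  have j4 := letterCount_one_eq_end j m
  have j5 := letterCount_zero_eq_end j m
  rw [abel2Class_eq_iff_counts]
  constructor
  · rintro ⟨hl, hp⟩
    have htm : tm i = tm j := by
      rw [hl, hp, hp, j3] at i3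
      omega
    have hrep : repCount i m = repCount j m := by rw [← i1, ← j1, hp, hp]
    exact ⟨htm, hrep, (letterCount_zero_sub_one_eq_iff htm hrep).1 (by rw [hl, hl])⟩
  · rintro ⟨htm, hrep, hpar⟩
    have hdiff := (letterCount_zero_sub_one_eq_iff htm hrep).2 hpar
    rw [← tm_add_eq_tm_add htm hrep] at j4 j5
    have l0 : letterCount i (m + 1) 0 = letterCount j (m + 1) 0 := by linarith
    have l1 : letterCount i (m + 1) 1 = letterCount j (m + 1) 1 := by linarith
    rw [← htm] at j3
    refine ⟨?_, ?_⟩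
    · rintro (_ | _ | x)
      · exact l0
      · exact l1
      · rw [letterCount_of_two_le _ _ (by omega), letterCount_of_two_le _ _ (by omega)]
    · rintro (_ | _ | x) (_ | _ | y)
      all_goals first
        | (simp only [zero_add]; linarith)
        | linarith
        | rw [pairCount_of_two_le _ _ (by omega), pairCount_of_two_le _ _ (by omega)]

theorem ncard_range_eq_of_eq_iff {ι α β : Type*} {g : ι → α} {h : ι → β}
    (H : ∀ i j, g i = g j ↔ h i = h j) : (Set.range g).ncard = (Set.range h).ncard := by
  refine Set.ncard_congr (fun a ha => h ha.choose) (fun a ha => ⟨_, rfl⟩) ?_ ?_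
  · intro a b ha hb hab
    rw [← ha.choose_spec, ← hb.choose_spec]
    exact (H _ _).2 hab
  · rintro _ ⟨i, rfl⟩
    exact ⟨g i, ⟨i, rfl⟩, (H _ _).1 (Exists.choose_spec (⟨i, rfl⟩ : g i ∈ Set.range g))⟩

/-- The complement of every factor occurs at a position of the same parity. -/
theorem exists_complement (m i : ℕ) :
    ∃ j, tm j = 1 - tm i ∧ repCount j m = repCount i m ∧ j % 2 = i % 2 := by
  have hlt : i + m + 1 < 2 ^ (i + m + 1) := Nat.lt_two_pow_self
  have hpos : 2 ^ (i + m + 1) % 2 = 0 := by rw [pow_succ]; omega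
  refine ⟨i + 2 ^ (i + m + 1), tm_add_two_pow _ _ (by omega), ?_, by omega⟩
  refine Finset.sum_congr rfl fun k hk => ?_
  rw [Finset.mem_range] at hk
  have h0 := tm_lt_two (i + k)
  have h1 := tm_lt_two (i + k + 1)
  rw [rep, rep, show i + 2 ^ (i + m + 1) + k = i + k + 2 ^ (i + m + 1) by ring,
    tm_add_two_pow _ _ (by omega), add_right_comm, tm_add_two_pow _ _ (by omega)]
  split_ifs <;> omega

theorem abel2Complexity_tm_succ {m : ℕ} {a b c d : ℤ}
    (h0 : (Set.range fun j => repCount (2 * j) m) = Set.Icc a b)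
    (h1 : (Set.range fun j => repCount (2 * j + 1) m) = Set.Icc c d) :
    abel2Complexity tm (m + 1) =
      2 * (((Finset.Icc (minRep m) (maxRep m)).filter Even).card +
        ((Finset.Icc a b).filter Odd).card + ((Finset.Icc c d).filter Odd).card) := by
  classical
  have hset : abel2Complexity tm (m + 1) = (Set.range (abel2Class (m + 1))).ncard := by
    rw [abel2Complexity]
    congr 1
    ext f
    simp only [Set.mem_ofPred_eq, Set.mem_range, eq_comm (a := f)]
    rfl
  have hinv : (Set.range (abel2Class (m + 1))).ncard = (Set.range fun i =>
      (tm i, repCount i m, if Odd (repCount i m) then i % 2 else 0)).ncard := by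
    refine ncard_range_eq_of_eq_iff fun i j => ?_
    rw [abel2Class_eq_iff, Prod.mk.injEq, Prod.mk.injEq]
    refine and_congr_right fun _ => and_congr_right fun h => ?_
    rw [← h]
    split_ifs with hodd <;> simp [hodd]
  have hrange : (Set.range fun i =>
      (tm i, repCount i m, if Odd (repCount i m) then i % 2 else 0)) =
      ↑(Finset.range 2 ×ˢ ((((Finset.Icc (minRep m) (maxRep m)).filter Even) ×ˢ {0} ∪
        ((Finset.Icc a b).filter Odd) ×ˢ {0}) ∪ ((Finset.Icc c d).filter Odd) ×ˢ {1})) := by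
    have hF := range_repCount m
    ext ⟨x, e, p⟩
    have hFe := Set.ext_iff.1 hF e
    have h0e := Set.ext_iff.1 h0 e
    have h1e := Set.ext_iff.1 h1 e
    simp only [Set.mem_range, Set.mem_Icc] at hFe h0e h1e
    simp only [Set.mem_range, Prod.mk.injEq, Finset.mem_coe, Finset.mem_product, Finset.mem_range,
      Finset.mem_union, Finset.mem_filter, Finset.mem_Icc, Finset.mem_singleton, ← hFe, ← h0e,
      ← h1e]
    constructor
    · rintro ⟨i, rfl, rfl, rfl⟩
      refine ⟨tm_lt_two i, ?_⟩
      split_ifs with hodd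
      · obtain ⟨j, rfl | rfl⟩ := Nat.even_or_odd' i
        · exact Or.inl (Or.inr ⟨⟨⟨j, rfl⟩, hodd⟩, by omega⟩)
        · exact Or.inr ⟨⟨⟨j, rfl⟩, hodd⟩, by omega⟩
      · exact Or.inl (Or.inl ⟨⟨⟨i, rfl⟩, Int.not_odd_iff_even.1 hodd⟩, rfl⟩)
    · rintro ⟨hx, h⟩
      have key : ∃ i, repCount i m = e ∧ (if Odd (repCount i m) then i % 2 else 0) = p := by
        rcases h with (⟨⟨⟨i, rfl⟩, hev⟩, rfl⟩ | ⟨⟨⟨i, rfl⟩, hodd⟩, rfl⟩) | ⟨⟨⟨i, rfl⟩, hodd⟩, rfl⟩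
        · exact ⟨i, rfl, if_neg (Int.not_odd_iff_even.2 hev)⟩
        · exact ⟨2 * i, rfl, by rw [if_pos hodd]; omega⟩
        · exact ⟨2 * i + 1, rfl, by rw [if_pos hodd]; omega⟩
      obtain ⟨i, he, hp⟩ := key
      by_cases hi : tm i = x
      · exact ⟨i, hi, he, hp⟩
      · obtain ⟨j, hj1, hj2, hj3⟩ := exists_complement m i
        have := tm_lt_two i
        exact ⟨j, by omega, hj2.trans he, by rw [hj2, hj3, hp]⟩
  rw [hset, hinv, hrange, Set.ncard_coe_finset, Finset.card_product, Finset.card_range,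
    Finset.card_union_of_disjoint, Finset.card_union_of_disjoint, Finset.card_product,
    Finset.card_product, Finset.card_product, Finset.card_singleton, Finset.card_singleton]
  · ring
  · rw [Finset.disjoint_left]
    simp only [Finset.mem_product, Finset.mem_filter, not_and]
    rintro ⟨e, p⟩ ⟨⟨-, hev⟩, -⟩ ⟨-, hodd⟩
    exact absurd hev (Int.not_even_iff_odd.2 hodd)
  · rw [Finset.disjoint_left]
    simp only [Finset.mem_product, Finset.mem_union, Finset.mem_singleton]
    rintro ⟨e, p⟩ h1 h2
    simp only at h1 h2
    omega

theorem two_mul_card_Icc_filter_odd {a b : ℤ} (h : a ≤ b) :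
    2 * (((Finset.Icc a b).filter Odd).card : ℤ) = b - a + a % 2 + b % 2 := by
  induction b, h using Int.leInduction with
  | base =>
    simp only [Finset.Icc_self, Finset.filter_singleton, Int.odd_iff]
    split_ifs <;> simp <;> omega
  | succ b hb ih =>
    have hins : Finset.Icc a (b + 1) = insert (b + 1) (Finset.Icc a b) := by
      ext x
      simp only [Finset.mem_insert, Finset.mem_Icc]
      omega
    rw [hins, Finset.filter_insert]
    split_ifs with hodd
    · rw [Finset.card_insert_of_notMem (by simp)]
      rw [Int.odd_iff] at hodd
      push_cast
      omega
    · rw [Int.odd_iff] at hodd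
      omega

theorem card_Icc_filter_even_add_odd {a b : ℤ} (h : a ≤ b) :
    (((Finset.Icc a b).filter Even).card : ℤ) + ((Finset.Icc a b).filter Odd).card = b - a + 1 := by
  have hodd : (Finset.Icc a b).filter Odd = (Finset.Icc a b).filter fun x => ¬Even x :=
    Finset.filter_congr fun x _ => Int.not_even_iff_odd.symm
  rw [hodd, ← Nat.cast_add, Finset.card_filter_add_card_filter_not, Int.card_Icc]
  omega

theorem range_repCount_const_sub {f : ℕ → ℤ} {n : ℕ} (hf : ∀ j, f j = n - repCount j n) :
    Set.range f = Set.Icc (n - maxRep n) (n - minRep n) := by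
  have : f = (fun x => (n : ℤ) - x) ∘ fun j => repCount j n := funext hf
  rw [this, Set.range_comp, range_repCount, Set.image_const_sub_Icc]

theorem abel2Complexity_tm_two_mul_add_one (k : ℕ) :
    (abel2Complexity tm (2 * k + 1) : ℤ) =
      3 * (maxRep k - minRep k) + (k + minRep k) % 2 + (k + maxRep k) % 2 + 2 := by
  have hle := minRep_le_maxRep k
  have hlek : (k : ℤ) - maxRep k ≤ k - minRep k := by omega
  have h := abel2Complexity_tm_succ
    (range_repCount_const_sub fun j => repCount_two_mul_two_mul j k)
    (range_repCount_const_sub fun j => repCount_two_mul_add_one_two_mul j k)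
  rw [maxRep_two_mul, minRep_two_mul] at h
  have h1 := two_mul_card_Icc_filter_odd hlek
  have h2 := card_Icc_filter_even_add_odd hlek
  omega

theorem abel2Complexity_tm_two_mul_add_two (k : ℕ) :
    (abel2Complexity tm (2 * k + 2) : ℤ) =
      3 + 2 * maxRep k - minRep k + maxRep (k + 1) - 2 * minRep (k + 1) +
        (k + minRep k) % 2 + (k + 1 + maxRep (k + 1)) % 2 := by
  have hle := minRep_le_maxRep k
  have hle' := minRep_le_maxRep (k + 1)
  have hlek : (k : ℤ) - maxRep k ≤ k - minRep k := by omega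
  have hlek' : ((k + 1 : ℕ) : ℤ) - maxRep (k + 1) ≤ (k + 1 : ℕ) - minRep (k + 1) := by omega
  have hle2 := minRep_le_maxRep (2 * k + 1)
  have h := abel2Complexity_tm_succ
    (range_repCount_const_sub fun j => repCount_two_mul_two_mul_add_one j k)
    (range_repCount_const_sub fun j => repCount_two_mul_add_one_two_mul_add_one j k)
  rw [maxRep_two_mul_add_one, minRep_two_mul_add_one] at h hle2
  have h1 := two_mul_card_Icc_filter_odd hlek
  have h2 := two_mul_card_Icc_filter_odd hlek'
  have h3 := two_mul_card_Icc_filter_odd hle2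
  have h4 := card_Icc_filter_even_add_odd hle2
  have h5 : ((k : ℤ) + minRep k) % 2 = (k - minRep k) % 2 := by omega
  have h6 : ((k : ℤ) + 1 + maxRep (k + 1)) % 2 = ((k + 1 : ℕ) - maxRep (k + 1)) % 2 := by omega
  rw [h, h5, h6]
  push_cast at *
  linarith

/-! ### A decimation-closed module containing the relevant sequences -/

/-- The extremal repetition counts and their shifts. -/
noncomputable def extRep : Bool × Bool → ℕ → ℤ
  | (true, c), n => maxRep (n + c.toNat)
  | (false, c), n => minRep (n + c.toNat)

/-- The parity of `a * n + b + extRep p n`. -/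
noncomputable def parityRep (q : ZMod 2 × ZMod 2 × (Bool × Bool)) (n : ℕ) : ℤ :=
  ((q.1 * (n : ZMod 2) + q.2.1 + (extRep q.2.2 n : ℤ)).val : ℤ)

theorem extRep_two_mul (p : Bool × Bool) :
    ∃ (b : ℤ) (p' : Bool × Bool), ∀ n, extRep p (2 * n) = n + b - extRep p' n := by
  rcases p with ⟨_ | _, _ | _⟩
  · exact ⟨0, (true, false), fun n => by simp [extRep, minRep_two_mul]⟩
  · exact ⟨0, (true, false), fun n => by simp [extRep, minRep_two_mul_add_one]⟩
  · exact ⟨0, (false, false), fun n => by simp [extRep, maxRep_two_mul]⟩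
  · exact ⟨1, (false, true), fun n => by simp [extRep, maxRep_two_mul_add_one]⟩

theorem extRep_two_mul_add_one (p : Bool × Bool) :
    ∃ (b : ℤ) (p' : Bool × Bool), ∀ n, extRep p (2 * n + 1) = n + b - extRep p' n := by
  have h : ∀ n : ℕ, 2 * n + 1 + 1 = 2 * (n + 1) := fun n => by ring
  rcases p with ⟨_ | _, _ | _⟩
  · exact ⟨0, (true, false), fun n => by simp [extRep, minRep_two_mul_add_one]⟩
  · exact ⟨1, (true, true), fun n => by simp [extRep, h, minRep_two_mul]⟩
  · exact ⟨1, (false, true), fun n => by simp [extRep, maxRep_two_mul_add_one]⟩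
  · exact ⟨1, (false, true), fun n => by simp [extRep, h, maxRep_two_mul]⟩

/-- Generators of a decimation-closed module of sequences. -/
noncomputable def repGenerators : Set (ℕ → ℤ) :=
  {fun _ => 1, fun n : ℕ => (n : ℤ)} ∪ Set.range extRep ∪ Set.range parityRep

theorem finite_repGenerators : repGenerators.Finite :=
  ((Set.toFinite _).union (Set.finite_range _)).union (Set.finite_range _)

theorem one_mem_span : (fun _ => 1 : ℕ → ℤ) ∈ Submodule.span ℤ repGenerators :=
  Submodule.subset_span (Or.inl (Or.inl (Or.inl rfl)))

theorem natCast_mem_span : (fun n : ℕ => (n : ℤ)) ∈ Submodule.span ℤ repGenerators :=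
  Submodule.subset_span (Or.inl (Or.inl (Or.inr rfl)))

theorem extRep_mem_span (p : Bool × Bool) : extRep p ∈ Submodule.span ℤ repGenerators :=
  Submodule.subset_span (Or.inl (Or.inr ⟨p, rfl⟩))

theorem parityRep_mem_span (q : ZMod 2 × ZMod 2 × (Bool × Bool)) :
    parityRep q ∈ Submodule.span ℤ repGenerators :=
  Submodule.subset_span (Or.inr ⟨q, rfl⟩)

theorem natCast_add_sub_extRep_mem_span {u : ℕ → ℤ}
    (hu : ∃ (b : ℤ) (p : Bool × Bool), ∀ n, u n = n + b - extRep p n) :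
    u ∈ Submodule.span ℤ repGenerators := by
  obtain ⟨b, p, h⟩ := hu
  have : u = (fun n : ℕ => (n : ℤ)) + b • (fun _ => 1 : ℕ → ℤ) - extRep p := by
    funext n
    simp [h]
  rw [this]
  exact sub_mem (add_mem natCast_mem_span (Submodule.smul_mem _ _ one_mem_span))
    (extRep_mem_span p)

theorem val_mem_span {u : ℕ → ℤ} (c : ZMod 2)
    (hu : ∃ (b : ℤ) (p : Bool × Bool), ∀ n, u n = n + b - extRep p n) :
    (fun n => ((c + (u n : ℤ) : ZMod 2).val : ℤ)) ∈ Submodule.span ℤ repGenerators := by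
  obtain ⟨b, p, h⟩ := hu
  convert parityRep_mem_span (1, c + b, p) using 1
  funext n
  rw [parityRep, h]
  push_cast
  rw [CharTwo.sub_eq_add]
  congr 2
  ring

theorem decimationClosed_span_repGenerators :
    DecimationClosed (Submodule.span ℤ repGenerators) := by
  refine decimationClosed_span ?_
  have h2 : (2 : ZMod 2) = 0 := rfl
  rintro s (((rfl | rfl) | ⟨p, rfl⟩) | ⟨q, rfl⟩)
  · exact ⟨one_mem_span, one_mem_span⟩
  · constructor
    · convert Submodule.smul_mem _ (2 : ℤ) natCast_mem_span using 1
      funext n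
      simp [evenPart, LinearMap.funLeft_apply]
    · convert add_mem (Submodule.smul_mem _ (2 : ℤ) natCast_mem_span) one_mem_span using 1
      funext n
      simp [oddPart, LinearMap.funLeft_apply]
  · exact ⟨natCast_add_sub_extRep_mem_span (extRep_two_mul p),
      natCast_add_sub_extRep_mem_span (extRep_two_mul_add_one p)⟩
  · constructor
    · convert val_mem_span q.2.1 (extRep_two_mul q.2.2) using 1
      funext n
      simp [evenPart, LinearMap.funLeft_apply, parityRep, h2]
    · convert val_mem_span (q.1 + q.2.1) (extRep_two_mul_add_one q.2.2) using 1
      funext n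
      simp [oddPart, LinearMap.funLeft_apply, parityRep, h2]

theorem parityRep_eq_emod (a b : ℤ) (p : Bool × Bool) (n : ℕ) :
    parityRep (a, b, p) n = (a * n + b + extRep p n) % 2 := by
  have := ZMod.val_intCast (n := 2) (a * n + b + extRep p n)
  rw [parityRep]
  push_cast at this
  exact this

theorem stmt19 : IsTwoRegular fun n => (abel2Complexity tm n : ℤ) := by
  refine isTwoRegular_of_odd_of_even_succ (Submodule.fg_span finite_repGenerators)
    decimationClosed_span_repGenerators ?_ ?_
  · convert add_mem (add_mem (add_mem (Submodule.smul_mem _ (3 : ℤ)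
      (sub_mem (extRep_mem_span (true, false)) (extRep_mem_span (false, false))))
      (parityRep_mem_span ((1 : ℤ), (0 : ℤ), (false, false))))
      (parityRep_mem_span ((1 : ℤ), (0 : ℤ), (true, false))))
      (Submodule.smul_mem _ (2 : ℤ) one_mem_span) using 1
    funext n
    simp only [abel2Complexity_tm_two_mul_add_one, Pi.add_apply, Pi.sub_apply, Pi.smul_apply,
      parityRep_eq_emod, smul_eq_mul]
    simp [extRep]
  · convert add_mem (add_mem (add_mem (Submodule.smul_mem _ (3 : ℤ) one_mem_span) (sub_mem (add_mem
      (sub_mem (Submodule.smul_mem _ (2 : ℤ) (extRep_mem_span (true, false)))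
      (extRep_mem_span (false, false))) (extRep_mem_span (true, true)))
      (Submodule.smul_mem _ (2 : ℤ) (extRep_mem_span (false, true)))))
      (parityRep_mem_span ((1 : ℤ), (0 : ℤ), (false, false))))
      (parityRep_mem_span ((1 : ℤ), (1 : ℤ), (true, true))) using 1
    funext n
    simp only [abel2Complexity_tm_two_mul_add_two, Pi.add_apply, Pi.sub_apply, Pi.smul_apply,
      parityRep_eq_emod, smul_eq_mul]
    simp [extRep]
    ring
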